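/- Let u, v, w, z be orthonormal vectors in ℝ⁸ spanning an L-plane. Then the 4-plane V spanned by R_{uvw} = u×v×w, R_{uvz} = u×v×z, R_{uwz} = u×w×z, R_{vwz} = v×w×z is also an L-plane, i.e., Ψ restricted to V vanishes (equivalently Ψ(R_{uvw}, R_{uvz}, R_{uwz}, R_{vwz}) = 0 together with vanishing on all quadruples from V). -/

import Mathlib

noncomputable section

/-- The octonions `𝕆 ≅ ℝ⁸`, realized as pairs of quaternions via Cayley–Dickson. -/
abbrev Octonion : Type := Quaternion ℝ × Quaternion ℝ

/-- Octonion multiplication (Cayley–Dickson doubling of the quaternions). -/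
def omul (p q : Octonion) : Octonion :=
  (p.1 * q.1 - star q.2 * p.2, q.2 * p.1 + p.2 * star q.1)

/-- Octonion conjugation. -/
def oconj (p : Octonion) : Octonion := (star p.1, -p.2)

/-- The standard inner product on the octonions `≅ ℝ⁸`. -/
def oinner (p q : Octonion) : ℝ := (p.1 * star q.1).re + (p.2 * star q.2).re

/-- The triple cross product `u×v×w = ½(u(v̄w) − w(v̄u))`. -/
def tcross (u v w : Octonion) : Octonion :=
  (2 : ℝ)⁻¹ • (omul u (omul (oconj v) w) - omul w (omul (oconj v) u))

/-- The Cayley 4-form `Ψ(u,v,w,z) = ⟨u×v×w, z⟩`. -/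
def cayleyΨ (u v w z : Octonion) : ℝ := oinner (tcross u v w) z

lemma oinner_eq (p q : Octonion) : oinner p q =
    p.1.re * q.1.re + p.1.imI * q.1.imI + p.1.imJ * q.1.imJ + p.1.imK * q.1.imK +
    (p.2.re * q.2.re + p.2.imI * q.2.imI + p.2.imJ * q.2.imJ + p.2.imK * q.2.imK) := by
  simp [oinner]

lemma oinner_comm (p q : Octonion) : oinner p q = oinner q p := by
  simp only [oinner_eq]; ring

lemma oinner_add_left (p p' q : Octonion) : oinner (p + p') q = oinner p q + oinner p' q := by
  simp [oinner_eq]; ring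

lemma oinner_smul_left (r : ℝ) (p q : Octonion) : oinner (r • p) q = r * oinner p q := by
  simp [oinner_eq]; ring

lemma oinner_add_right (p q q' : Octonion) : oinner p (q + q') = oinner p q + oinner p q' := by
  simp [oinner_eq]; ring

lemma oinner_smul_right (r : ℝ) (p q : Octonion) : oinner p (r • q) = r * oinner p q := by
  simp [oinner_eq]; ring

lemma oinner_neg_left (p q : Octonion) : oinner (-p) q = -oinner p q := by
  simp [oinner_eq]; ring

lemma oinner_zero_left (q : Octonion) : oinner 0 q = 0 := by
  simpa using oinner_smul_left 0 0 q

lemma oinner_zero_right (p : Octonion) : oinner p 0 = 0 := by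
  simpa using oinner_smul_right 0 p 0

lemma eq_of_oinner_eq {p q : Octonion} (h : ∀ x, oinner p x = oinner q x) : p = q := by
  have h₀ : oinner (p + -q) (p + -q) = 0 := by
    rw [oinner_add_left, oinner_neg_left, h]; ring
  rw [← add_neg_eq_zero]
  generalize p + -q = r at h₀ ⊢
  rw [oinner_eq] at h₀
  ext
  all_goals
    change _ = (0 : ℝ)
    nlinarith [sq_nonneg r.1.re, sq_nonneg r.1.imI, sq_nonneg r.1.imJ, sq_nonneg r.1.imK,
      sq_nonneg r.2.re, sq_nonneg r.2.imI, sq_nonneg r.2.imJ, sq_nonneg r.2.imK]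

lemma oinner_neg_right (p q : Octonion) : oinner p (-q) = -oinner p q := by
  simp [oinner_eq]; ring

/-- Polarized multiplicativity of the octonion norm. -/
lemma oinner_omul_omul_add_swap (a d x y : Octonion) :
    oinner (omul a x) (omul d y) + oinner (omul d x) (omul a y) =
      2 * oinner a d * oinner x y := by
  simp [oinner_eq, omul]; ring

lemma oinner_omul_omul_left (a x y : Octonion) :
    oinner (omul a x) (omul a y) = oinner a a * oinner x y := by
  linarith [oinner_omul_omul_add_swap a a x y]

lemma oinner_oconj (a b : Octonion) : oinner (oconj a) (oconj b) = oinner a b := by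
  simp [oinner_eq, oconj]

/-- The unsymmetrized triple product `a(b̄c)`. -/
def otriple (a b c : Octonion) : Octonion := omul a (omul (oconj b) c)

lemma oinner_omul_left (a x y : Octonion) : oinner (omul a x) y = oinner x (omul (oconj a) y) := by
  simp [oinner_eq, omul, oconj]; ring

lemma omul_add_right (a x y : Octonion) : omul a (x + y) = omul a x + omul a y := by
  ext <;> simp [omul] <;> ring

lemma omul_add_left (a b x : Octonion) : omul (a + b) x = omul a x + omul b x := by
  ext <;> simp [omul] <;> ring

lemma omul_smul_right (r : ℝ) (a x : Octonion) : omul a (r • x) = r • omul a x := by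
  ext <;> simp [omul] <;> ring

lemma omul_smul_left (r : ℝ) (a x : Octonion) : omul (r • a) x = r • omul a x := by
  ext <;> simp [omul] <;> ring

lemma omul_coe (a : Octonion) (r : ℝ) : omul a ((r : Quaternion ℝ), 0) = r • a := by
  ext <;> simp [omul, mul_comm]

lemma omul_oconj_add_swap (b c : Octonion) :
    omul (oconj b) c + omul (oconj c) b = (((2 * oinner b c : ℝ) : Quaternion ℝ), 0) := by
  ext <;> simp [oinner_eq, omul, oconj] <;> ring

lemma otriple_add_swap_left (a b c : Octonion) :
    otriple a b c + otriple b a c = (2 * oinner a b) • c := by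
  refine eq_of_oinner_eq fun x => ?_
  rw [oinner_add_left, otriple, otriple, oinner_omul_left, oinner_omul_left b, add_comm,
    oinner_smul_left, oinner_omul_omul_add_swap, oinner_oconj]

lemma otriple_add_swap_right (a b c : Octonion) :
    otriple a b c + otriple a c b = (2 * oinner b c) • a := by
  rw [otriple, otriple, ← omul_add_right, omul_oconj_add_swap, omul_coe]

lemma otriple_swap_left {a b : Octonion} (h : oinner a b = 0) (c : Octonion) :
    otriple a b c = -otriple b a c := by
  exact eq_neg_of_add_eq_zero_left (by simpa [h] using otriple_add_swap_left a b c)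

lemma otriple_swap_right {b c : Octonion} (h : oinner b c = 0) (a : Octonion) :
    otriple a b c = -otriple a c b := by
  exact eq_neg_of_add_eq_zero_left (by simpa [h] using otriple_add_swap_right a b c)

lemma tcross_eq_otriple_sub (a b c : Octonion) :
    tcross a b c = (2 : ℝ)⁻¹ • (otriple a b c - otriple c b a) := rfl

lemma tcross_eq_otriple {a b c : Octonion} (hab : oinner a b = 0) (hac : oinner a c = 0)
    (hbc : oinner b c = 0) : tcross a b c = otriple a b c := by
  have h : otriple c b a = -otriple a b c := by
    rw [otriple_swap_left ((oinner_comm c b).trans hbc),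
      otriple_swap_right ((oinner_comm c a).trans hac), otriple_swap_left ((oinner_comm b a).trans hab)]
    simp
  rw [tcross_eq_otriple_sub, h, sub_neg_eq_add, ← two_smul ℝ, smul_smul]
  simp

lemma tcross_swap_left (a b c : Octonion) : tcross a b c = -tcross b a c := by
  have h : otriple a b c + otriple b a c = otriple c a b + otriple c b a := by
    rw [otriple_add_swap_left, otriple_add_swap_right]
  rw [← add_eq_zero_iff_eq_neg, tcross_eq_otriple_sub, tcross_eq_otriple_sub, ← smul_add,
    sub_add_sub_comm, h, add_comm (otriple c a b), sub_self, smul_zero]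

lemma tcross_swap_right (a b c : Octonion) : tcross a b c = -tcross a c b := by
  have h : otriple a b c + otriple a c b = otriple c b a + otriple b c a := by
    rw [otriple_add_swap_left, otriple_add_swap_right, oinner_comm]
  rw [← add_eq_zero_iff_eq_neg, tcross_eq_otriple_sub, tcross_eq_otriple_sub, ← smul_add,
    sub_add_sub_comm, h, sub_self, smul_zero]

lemma tcross_rotate (a b c : Octonion) : tcross a b c = tcross b c a := by
  rw [tcross_swap_left, tcross_swap_right, neg_neg]

lemma eq_zero_of_eq_neg {p : Octonion} (h : p = -p) : p = 0 := by
  rw [eq_neg_iff_add_eq_zero, ← two_smul ℝ] at h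
  simpa only [smul_smul, inv_mul_cancel₀ (two_ne_zero' ℝ), one_smul, smul_zero] using
    congrArg ((2 : ℝ)⁻¹ • ·) h

lemma tcross_self_left (a b : Octonion) : tcross a a b = 0 :=
  eq_zero_of_eq_neg (tcross_swap_left a a b)

lemma tcross_self_right (a b : Octonion) : tcross a b b = 0 :=
  eq_zero_of_eq_neg (tcross_swap_right a b b)

lemma tcross_self_outer (a b : Octonion) : tcross a b a = 0 := by
  rw [tcross_swap_right, tcross_self_left, neg_zero]

lemma tcross_add_left (a a' b c : Octonion) :
    tcross (a + a') b c = tcross a b c + tcross a' b c := by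
  simp only [tcross, omul_add_left, omul_add_right]
  module

lemma tcross_smul_left (r : ℝ) (a b c : Octonion) : tcross (r • a) b c = r • tcross a b c := by
  simp only [tcross, omul_smul_left, omul_smul_right]
  module

lemma oinner_otriple_swap {a d : Octonion} (had : oinner a d = 0) (b c e f : Octonion) :
    oinner (otriple a b c) (otriple d e f) = -oinner (otriple d b c) (otriple a e f) := by
  have h := oinner_omul_omul_add_swap a d (omul (oconj b) c) (omul (oconj e) f)
  rw [had, mul_zero, zero_mul] at h
  exact eq_neg_of_add_eq_zero_left h

/-- Triple products of two mutually orthogonal orthogonal triples are orthogonal: the pairing is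
alternating in all six vectors, while exchanging the triples is an odd permutation. -/
lemma oinner_otriple_eq_zero {a b c d e f : Octonion}
    (hab : oinner a b = 0) (hac : oinner a c = 0) (hbc : oinner b c = 0)
    (hde : oinner d e = 0) (hdf : oinner d f = 0) (hef : oinner e f = 0)
    (had : oinner a d = 0) (hae : oinner a e = 0) (haf : oinner a f = 0)
    (hbd : oinner b d = 0) (hbe : oinner b e = 0) (hbf : oinner b f = 0)
    (hcd : oinner c d = 0) (hce : oinner c e = 0) (hcf : oinner c f = 0) :
    oinner (otriple a b c) (otriple d e f) = 0 := by
  have rotate {x y t : Octonion} (hxy : oinner x y = 0) (hxt : oinner x t = 0) :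
      otriple x y t = otriple y t x := by
    rw [otriple_swap_left hxy, otriple_swap_right hxt, neg_neg]
  have s (x y : Octonion) (h : oinner x y = 0) : oinner y x = 0 := (oinner_comm y x).trans h
  have key : oinner (otriple a b c) (otriple d e f) =
      -oinner (otriple d e f) (otriple a b c) := by
    rw [oinner_otriple_swap had, rotate (s _ _ hbd) (s _ _ hcd), rotate hae haf,
      oinner_otriple_swap hbe, rotate (s _ _ hce) (s _ _ hde), rotate hbf (s _ _ hab),
      oinner_otriple_swap hcf, rotate (s _ _ hdf) (s _ _ hef), rotate (s _ _ hac) (s _ _ hbc)]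
    simp
  rw [oinner_comm (otriple d e f)] at key
  linarith

lemma oinner_tcross_tcross {a b c d : Octonion} (hab : oinner a b = 0) (hac : oinner a c = 0)
    (hbc : oinner b c = 0) (had : oinner a d = 0) (hbd : oinner b d = 0)
    (hcd : oinner c d = 0) : oinner (tcross a b c) (tcross a b d) = 0 := by
  rw [tcross_eq_otriple hab hac hbc, tcross_eq_otriple hab had hbd, otriple, otriple,
    oinner_omul_omul_left, oinner_omul_omul_left, hcd, mul_zero, mul_zero]

/-- The Cayley form is linear in each argument, so it vanishes on a span as soon as it vanishes on
the generators. -/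
lemma cayleyΨ_eq_zero_of_span {S : Set Octonion}
    (h : ∀ a ∈ S, ∀ b ∈ S, ∀ c ∈ S, ∀ d ∈ S, cayleyΨ a b c d = 0) :
    ∀ a ∈ Submodule.span ℝ S, ∀ b ∈ Submodule.span ℝ S, ∀ c ∈ Submodule.span ℝ S,
      ∀ d ∈ Submodule.span ℝ S, cayleyΨ a b c d = 0 := by
  have left {b c d : Octonion} (h : ∀ a ∈ S, oinner (tcross a b c) d = 0) :
      ∀ a ∈ Submodule.span ℝ S, oinner (tcross a b c) d = 0 := by
    intro a ha
    induction ha using Submodule.span_induction with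
    | mem x hx => exact h x hx
    | zero => rw [← zero_smul ℝ (0 : Octonion), tcross_smul_left, zero_smul, oinner_zero_left]
    | add x y _ _ hx hy => rw [tcross_add_left, oinner_add_left, hx, hy, add_zero]
    | smul r x _ hx => rw [tcross_smul_left, oinner_smul_left, hx, mul_zero]
  have right {p : Octonion} (h : ∀ d ∈ S, oinner p d = 0) :
      ∀ d ∈ Submodule.span ℝ S, oinner p d = 0 := by
    intro d hd
    induction hd using Submodule.span_induction with
    | mem x hx => exact h x hx
    | zero => exact oinner_zero_right p
    | add x y _ _ hx hy => rw [oinner_add_right, hx, hy, add_zero]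
    | smul r x _ hx => rw [oinner_smul_right, hx, mul_zero]
  intro a ha b hb c hc d hd
  refine left (fun a ha => ?_) a ha
  rw [tcross_rotate]
  refine left (fun b hb => ?_) b hb
  rw [tcross_rotate]
  refine left (fun c hc => ?_) c hc
  rw [tcross_rotate]
  exact right (h a ha b hb c hc) d hd

/-- if orthonormal `u, v, w, z` span an L-plane, then the 4-plane
spanned by `R_{uvw} = u×v×w`, `R_{uvz} = u×v×z`, `R_{uwz} = u×w×z`,
`R_{vwz} = v×w×z` is also an L-plane: `Ψ` vanishes identically on it. -/
theorem complementary_plane_is_L_plane (u v w z : Octonion)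
    (horth : ∀ i j : Fin 4,
      oinner (![u, v, w, z] i) (![u, v, w, z] j) = if i = j then 1 else 0)
    (hL : ∀ a ∈ Submodule.span ℝ {u, v, w, z}, ∀ b ∈ Submodule.span ℝ {u, v, w, z},
      ∀ c ∈ Submodule.span ℝ {u, v, w, z}, ∀ d ∈ Submodule.span ℝ {u, v, w, z},
        cayleyΨ a b c d = 0) :
    ∀ a ∈ Submodule.span ℝ {tcross u v w, tcross u v z, tcross u w z, tcross v w z},
      ∀ b ∈ Submodule.span ℝ {tcross u v w, tcross u v z, tcross u w z, tcross v w z},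
        ∀ c ∈ Submodule.span ℝ {tcross u v w, tcross u v z, tcross u w z, tcross v w z},
          ∀ d ∈ Submodule.span ℝ
              ({tcross u v w, tcross u v z, tcross u w z, tcross v w z} : Set Octonion),
            cayleyΨ a b c d = 0 := by
  have huv : oinner u v = 0 := by simpa using horth 0 1
  have huw : oinner u w = 0 := by simpa using horth 0 2
  have huz : oinner u z = 0 := by simpa using horth 0 3
  have hvw : oinner v w = 0 := by simpa using horth 1 2
  have hvz : oinner v z = 0 := by simpa using horth 1 3
  have hwz : oinner w z = 0 := by simpa using horth 2 3
  have hwv := (oinner_comm w v).trans hvw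
  have hzv := (oinner_comm z v).trans hvz
  have hzw := (oinner_comm z w).trans hwz
  have hvu := (oinner_comm v u).trans huv
  have hwu := (oinner_comm w u).trans huw
  have hzu := (oinner_comm z u).trans huz
  have h₁₂ : oinner (tcross u v w) (tcross u v z) = 0 :=
    oinner_tcross_tcross huv huw hvw huz hvz hwz
  have h₁₃ : oinner (tcross u v w) (tcross u w z) = 0 := by
    rw [tcross_swap_right u v w, oinner_neg_left,
      oinner_tcross_tcross huw huv hwv huz hwz hvz, neg_zero]
  have h₁₄ : oinner (tcross u v w) (tcross v w z) = 0 := by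
    rw [tcross_rotate u v w]
    exact oinner_tcross_tcross hvw hvu hwu hvz hwz huz
  have h₂₃ : oinner (tcross u v z) (tcross u w z) = 0 := by
    rw [tcross_swap_right u v z, tcross_swap_right u w z, oinner_neg_left, oinner_neg_right,
      oinner_tcross_tcross huz huv hzv huw hzw hvw, neg_zero, neg_zero]
  have h₂₄ : oinner (tcross u v z) (tcross v w z) = 0 := by
    rw [tcross_rotate u v z, tcross_swap_right v w z, oinner_neg_right,
      oinner_tcross_tcross hvz hvu hzu hvw hzw huw, neg_zero]
  have h₃₄ : oinner (tcross u w z) (tcross v w z) = 0 := by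
    rw [tcross_rotate u w z, tcross_rotate v w z]
    exact oinner_tcross_tcross hwz hwu hzu hwv hzv huv
  have orthogonal_or_eq : ∀ a ∈ ({tcross u v w, tcross u v z, tcross u w z, tcross v w z} :
      Set Octonion), ∀ b ∈ ({tcross u v w, tcross u v z, tcross u w z, tcross v w z} :
      Set Octonion), a = b ∨ oinner a b = 0 := by
    rintro a (rfl | rfl | rfl | rfl) b (rfl | rfl | rfl | rfl) <;>
      first
      | exact Or.inl rfl
      | exact Or.inr (by assumption)
      | exact Or.inr ((oinner_comm _ _).trans (by assumption))
  have mem_span : ∀ x ∈ ({u, v, w, z} : Set Octonion), x ∈ Submodule.span ℝ {u, v, w, z} :=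
    fun _ hx => Submodule.subset_span hx
  have hu := mem_span u (by simp)
  have hv := mem_span v (by simp)
  have hw := mem_span w (by simp)
  have hz := mem_span z (by simp)
  have normal : ∀ a ∈ ({tcross u v w, tcross u v z, tcross u w z, tcross v w z} :
      Set Octonion), ∀ x ∈ Submodule.span ℝ {u, v, w, z}, oinner a x = 0 := by
    rintro a (rfl | rfl | rfl | rfl) x hx
    · exact hL u hu v hv w hw x hx
    · exact hL u hu v hv z hz x hx
    · exact hL u hu w hw z hz x hx
    · exact hL v hv w hw z hz x hx
  refine cayleyΨ_eq_zero_of_span fun a ha b hb c hc d hd => ?_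
  rw [cayleyΨ]
  rcases orthogonal_or_eq a ha b hb with rfl | hab
  · rw [tcross_self_left, oinner_zero_left]
  rcases orthogonal_or_eq b hb c hc with rfl | hbc
  · rw [tcross_self_right, oinner_zero_left]
  rcases orthogonal_or_eq a ha c hc with rfl | hac
  · rw [tcross_self_outer, oinner_zero_left]
  have pairing {x y t : Octonion} (hx : x ∈ Submodule.span ℝ {u, v, w, z})
      (hy : y ∈ Submodule.span ℝ {u, v, w, z}) (ht : t ∈ Submodule.span ℝ {u, v, w, z})
      (hxy : oinner x y = 0) (hxt : oinner x t = 0) (hyt : oinner y t = 0) :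
      oinner (tcross a b c) (tcross x y t) = 0 := by
    rw [tcross_eq_otriple hab hac hbc, tcross_eq_otriple hxy hxt hyt]
    exact oinner_otriple_eq_zero hab hac hbc hxy hxt hyt
      (normal a ha x hx) (normal a ha y hy) (normal a ha t ht)
      (normal b hb x hx) (normal b hb y hy) (normal b hb t ht)
      (normal c hc x hx) (normal c hc y hy) (normal c hc t ht)
  rcases hd with rfl | rfl | rfl | rfl
  · exact pairing hu hv hw huv huw hvw
  · exact pairing hu hv hz huv huz hvz
  · exact pairing hu hw hz huw huz hwz
  · exact pairing hv hw hz hvw hvz hwz
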